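/- (SLH closing 2-opt type 2.) Let G be a simple graph on n ≥ 3 vertices and let L be a circle ordering of G written cyclically as L = X ++ Y, where X = (x, …, b) and Y = (a, …, y) are nonempty segments (possibly of length one, in which case x = b or a = y). Suppose {y, x} is a gap of L and {x, a} and {y, b} are edges of G. Then the circle ordering L′ = X.reverse ++ Y = (b, …, x, a, …, y) satisfies g(L′) ≤ g(L) − 1. -/

import Mathlib

variable {V : Type*}

/-- The adjacent pairs of a circle ordering `L`: the unordered pairs
`{vᵢ, vᵢ₊₁}` (indices mod `L.length`). -/
def adjPairs (L : List V) : List (Sym2 V) :=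
  (L.zip (L.rotate 1)).map (fun p => s(p.1, p.2))

/-- `L` is a circle ordering of the vertex set `V`: a list containing every
vertex exactly once, regarded cyclically. -/
def IsCircleOrdering [Fintype V] (L : List V) : Prop :=
  L.Nodup ∧ ∀ v : V, v ∈ L

/-- `g(L)`: the number of gaps of `L`, i.e. adjacent pairs of `L` that are
not edges of `G`. -/
noncomputable def numGaps (G : SimpleGraph V) (L : List V) : ℕ :=
  (adjPairs L).countP (fun e => @decide (e ∉ G.edgeSet) (Classical.propDecidable _))

/-- `dist(L, H) = n - (number of adjacent pairs of `L` lying in the edge set `H`)`. -/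
noncomputable def distTo (H : Set (Sym2 V)) (L : List V) : ℕ :=
  L.length - (adjPairs L).countP (fun e => @decide (e ∈ H) (Classical.propDecidable _))

/-- `Δ(L, H) = g(L)/3 + dist(L, H)`. -/
noncomputable def delta (G : SimpleGraph V) (H : Set (Sym2 V)) (L : List V) : ℚ :=
  (numGaps G L : ℚ) / 3 + (distTo H L : ℚ)

/-- Two circle orderings are equivalent iff one is obtained from the other by a
cyclic rotation, a reversal of the order, or a composition of both. -/
def OrderEquiv (L M : List V) : Prop :=
  (∃ k, M = L.rotate k) ∨ (∃ k, M = L.reverse.rotate k)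

/-- A γ-move maps an ordering `A ++ B` (with `A`, `B` nonempty) to
`A.reverse ++ B`. -/
def GammaMove (L M : List V) : Prop :=
  ∃ A B : List V, A ≠ [] ∧ B ≠ [] ∧ L = A ++ B ∧ M = A.reverse ++ B

/-- A κ-move maps an ordering `A ++ B ++ C ++ D` (with `A`, `B`, `D` nonempty,
`C` possibly empty) to `A.reverse ++ B.reverse ++ D ++ C.reverse`. -/
def KappaMove (L M : List V) : Prop :=
  ∃ A B C D : List V, A ≠ [] ∧ B ≠ [] ∧ D ≠ [] ∧
    L = A ++ B ++ C ++ D ∧ M = A.reverse ++ B.reverse ++ D ++ C.reverse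

/-- A γ-move applied up to equivalence: the ordering may first be replaced by
any equivalent ordering. -/
def GammaStep (L M : List V) : Prop := ∃ L', OrderEquiv L L' ∧ GammaMove L' M

/-- A κ-move applied up to equivalence. -/
def KappaStep (L M : List V) : Prop := ∃ L', OrderEquiv L L' ∧ KappaMove L' M

/-- `M` is obtained from `L` by applying at most one κ-move and at most one
γ-move (in some order), each up to equivalence. -/
def KGStep (L M : List V) : Prop :=
  OrderEquiv L M ∨ GammaStep L M ∨ KappaStep L M ∨
    (∃ K, KappaStep L K ∧ GammaStep K M) ∨
    (∃ K, GammaStep L K ∧ KappaStep K M)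

/-- The pairs of consecutive entries of a list, without wrapping around. -/
def pathPairs : List V → List (Sym2 V)
  | [] => []
  | [_] => []
  | u :: v :: l => s(u, v) :: pathPairs (v :: l)

theorem pathPairs_append {X Y : List V} {b a : V}
    (hb : X.getLast? = some b) (ha : Y.head? = some a) :
    pathPairs (X ++ Y) = pathPairs X ++ s(b, a) :: pathPairs Y := by
  obtain ⟨Q, rfl⟩ := List.head?_eq_some_iff.mp ha
  obtain ⟨P, rfl⟩ := List.getLast?_eq_some_iff.mp hb
  clear ha hb
  induction P with
  | nil => simp [pathPairs]
  | cons u P ih => cases P <;> simp_all [pathPairs]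

theorem pathPairs_reverse (X : List V) :
    pathPairs X.reverse = (pathPairs X).reverse := by
  induction X with
  | nil => rfl
  | cons u l ih =>
    cases l with
    | nil => rfl
    | cons v l =>
      rw [List.reverse_cons, pathPairs_append (b := v) (a := u) (by simp) rfl, ih]
      simp [pathPairs, Sym2.eq_swap]

theorem adjPairs_cons (x : V) (l : List V) :
    adjPairs (x :: l) = pathPairs (x :: l ++ [x]) := by
  have key : ∀ c : V, ((c :: l).zip (l ++ [x])).map (fun p => s(p.1, p.2)) =
      pathPairs (c :: l ++ [x]) := by
    induction l with
    | nil => intro c; rfl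
    | cons u l ih => intro c; simpa [pathPairs] using ih u
  simpa [adjPairs] using key x

theorem adjPairs_append {X Y : List V} {x b a y : V}
    (hx : X.head? = some x) (hb : X.getLast? = some b)
    (ha : Y.head? = some a) (hy : Y.getLast? = some y) :
    adjPairs (X ++ Y) = pathPairs X ++ s(b, a) :: (pathPairs Y ++ [s(y, x)]) := by
  have h : adjPairs (X ++ Y) = pathPairs (X ++ (Y ++ [x])) := by
    obtain ⟨P, rfl⟩ := List.head?_eq_some_iff.mp hx
    simpa using adjPairs_cons x (P ++ Y)
  rw [h, pathPairs_append hb (a := a) (by simp [ha]),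
    pathPairs_append hy (a := x) rfl]
  rfl

/-- SLH closing 2-opt type 2: if `{y,x}` is a gap of
`L = (x,…,b) ++ (a,…,y)` and `{x,a}`, `{y,b}` are edges of `G`, then reversing
the first segment reduces the number of gaps by at least 1. -/
theorem stmt8 [Fintype V] (G : SimpleGraph V) (hn : 3 ≤ Fintype.card V)
    (X Y : List V) (x b a y : V)
    (hX : X ≠ []) (hY : Y ≠ [])
    (hx : X.head? = some x) (hb : X.getLast? = some b)
    (ha : Y.head? = some a) (hy : Y.getLast? = some y)
    (hL : IsCircleOrdering (X ++ Y))
    (hgap : s(y, x) ∉ G.edgeSet)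
    (hedge1 : s(x, a) ∈ G.edgeSet) (hedge2 : s(y, b) ∈ G.edgeSet) :
    numGaps G (X.reverse ++ Y) + 1 ≤ numGaps G (X ++ Y) := by
  have h' := adjPairs_append (X := X.reverse) (x := b) (b := x)
    (by simpa using hb) (by simpa using hx) ha hy
  simp only [numGaps, adjPairs_append hx hb ha hy, h', pathPairs_reverse,
    List.countP_append, List.countP_cons, List.countP_reverse, List.countP_nil]
  simp [hgap, hedge1, hedge2]
  omega
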